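/- arXiv:1704.07369 — 2 statements merged into one kernel-verified Lean document; each statement's English description precedes it below -/
import Mathlib

section
/- With the discrete Fourier setup and the coefficients A_{pq}^{rs} defined from the symmetric kernel modes B̂, for every F : K → ℂ and every r ∈ K, the loss part of the Fourier collocation collision term can be written in discrete-velocity form: Σ_{p,q,s∈K} A_{pq}^{rs} F_r F_s = Σ_{l,m∈K} B̂(m,m) F̂_l F̂_m ω^{(l+m)·r}. -/
open scoped BigOperators

noncomputable section

/-- The finite set of Fourier modes `K = {k ∈ ℤ^d : |k_i| ≤ n}`. -/
def K (d n : ℕ) : Finset (Fin d → ℤ) := Fintype.piFinset fun _ => Finset.Icc (-(n : ℤ)) n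

/-- Integer dot product on `ℤ^d`. -/
def dotZ {d : ℕ} (k p : Fin d → ℤ) : ℤ := ∑ i, k i * p i

/-- The root of unity power `ω^a = exp(2πi a / N)`. -/
def ω (N : ℕ) (a : ℤ) : ℂ := Complex.exp (2 * Real.pi * Complex.I * a / N)

/-- The indicator `1_N(l)`, equal to `1` if `l ≡ 0 (mod N)` componentwise and `0` otherwise. -/
def indN (N : ℕ) {d : ℕ} (l : Fin d → ℤ) : ℂ := if ∀ i, (N : ℤ) ∣ l i then 1 else 0

/-- The symmetric modulo map: the unique element of `K d n` congruent to `l` modulo `N = 2n+1`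
componentwise. -/
def smod (n : ℕ) {d : ℕ} (l : Fin d → ℤ) : Fin d → ℤ :=
  fun i => (l i + n) % (2 * n + 1) - n

/-- Discrete Fourier coefficients `F̂_k = N^{-d} Σ_{p ∈ K} F_p ω^{-k·p}`. -/
def Fhat (d n : ℕ) (F : (Fin d → ℤ) → ℂ) (k : Fin d → ℤ) : ℂ :=
  ((2 * n + 1 : ℂ) ^ d)⁻¹ * ∑ p ∈ K d n, F p * ω (2 * n + 1) (-(dotZ k p))

/-- The discrete-velocity-method coefficients `A_{pq}^{rs}` obtained from the kernel modes `B̂`. -/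
def Acoef (d n : ℕ) (Bh : (Fin d → ℤ) → (Fin d → ℤ) → ℂ) (p q r s : Fin d → ℤ) : ℂ :=
  ((2 * n + 1 : ℂ) ^ (3 * d))⁻¹ *
    ∑ l ∈ K d n, ∑ m ∈ K d n, ∑ k ∈ K d n, ∑ j ∈ K d n,
      indN (2 * n + 1) (l + m - k - j) * Bh (smod n (l - j)) (smod n (m - j)) *
        ω (2 * n + 1) (-(dotZ l p)) * ω (2 * n + 1) (-(dotZ m q)) *
        ω (2 * n + 1) (dotZ k r) * ω (2 * n + 1) (dotZ j s)

theorem ω_add (N : ℕ) (a b : ℤ) : ω N (a + b) = ω N a * ω N b := by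
  simp only [ω, ← Complex.exp_add]
  congr 1
  push_cast
  ring

theorem ω_sum (N : ℕ) {ι : Type*} (s : Finset ι) (f : ι → ℤ) :
    ω N (∑ i ∈ s, f i) = ∏ i ∈ s, ω N (f i) := by
  simp only [ω, ← Complex.exp_sum]
  congr 1
  push_cast
  rw [Finset.mul_sum, Finset.sum_div]

theorem ω_mul_natCast (N : ℕ) (a : ℤ) (k : ℕ) : ω N (a * k) = ω N a ^ k := by
  simp only [ω, ← Complex.exp_nat_mul]
  congr 1
  push_cast
  ring

theorem ω_eq_one_iff {N : ℕ} (hN : N ≠ 0) (a : ℤ) : ω N a = 1 ↔ (N : ℤ) ∣ a := by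
  have hN' : (N : ℂ) ≠ 0 := Nat.cast_ne_zero.mpr hN
  have hpi : (2 * Real.pi * Complex.I : ℂ) ≠ 0 := Complex.two_pi_I_ne_zero
  rw [ω, Complex.exp_eq_one_iff]
  refine exists_congr fun c => ?_
  rw [div_eq_iff hN', mul_comm (c : ℂ), mul_assoc _ (c : ℂ), mul_right_inj' hpi,
    mul_comm (N : ℤ)]
  exact_mod_cast Iff.rfl

theorem sum_Icc_neg_eq_sum_range (n : ℕ) (f : ℤ → ℂ) :
    ∑ x ∈ Finset.Icc (-(n : ℤ)) n, f x = ∑ i ∈ Finset.range (2 * n + 1), f (i - n) := by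
  symm
  refine Finset.sum_bij (fun i _ => (i : ℤ) - n) ?_ ?_ ?_ ?_
  · intro i hi
    simp only [Finset.mem_range, Finset.mem_Icc] at *
    omega
  · intro i _ j _ h
    omega
  · intro x hx
    simp only [Finset.mem_range, Finset.mem_Icc] at *
    exact ⟨(x + n).toNat, by omega, by omega⟩
  · intro _ _
    rfl

theorem sum_ω_mul (n : ℕ) (a : ℤ) :
    ∑ x ∈ Finset.Icc (-(n : ℤ)) n, ω (2 * n + 1) (a * x)
      = if ((2 * n + 1 : ℕ) : ℤ) ∣ a then (2 * n + 1 : ℂ) else 0 := by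
  have hN : 2 * n + 1 ≠ 0 := by omega
  split_ifs with h
  · rw [Finset.sum_congr rfl fun x _ => (ω_eq_one_iff hN _).mpr (h.mul_right x),
      sum_Icc_neg_eq_sum_range]
    simp
  · rw [sum_Icc_neg_eq_sum_range]
    have hz : ω (2 * n + 1) a ≠ 1 := mt (ω_eq_one_iff hN a).mp h
    have hzN : ω (2 * n + 1) a ^ (2 * n + 1) = 1 := by
      rw [← ω_mul_natCast]
      exact (ω_eq_one_iff hN _).mpr (dvd_mul_left _ _)
    have hx : ∀ x : ℕ, ω (2 * n + 1) (a * (x - n))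
        = ω (2 * n + 1) a ^ x * ω (2 * n + 1) (-(a * n)) := fun x => by
      rw [← ω_mul_natCast, ← ω_add, mul_sub, sub_eq_add_neg]
    simp only [hx]
    rw [← Finset.sum_mul, geom_sum_eq hz, hzN]
    simp

theorem sum_ω_dotZ (d n : ℕ) (l : Fin d → ℤ) :
    ∑ p ∈ K d n, ω (2 * n + 1) (dotZ l p)
      = if ∀ i, ((2 * n + 1 : ℕ) : ℤ) ∣ l i then (2 * n + 1 : ℂ) ^ d else 0 := by
  simp only [dotZ, ω_sum, K]
  rw [Finset.sum_prod_piFinset (Finset.Icc (-(n : ℤ)) n)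
    (fun i x => ω (2 * n + 1) (l i * x))]
  simp only [sum_ω_mul]
  split_ifs with h
  · simp only [h, if_true, Finset.prod_const, Finset.card_univ, Fintype.card_fin]
  · push Not at h
    obtain ⟨i, hi⟩ := h
    exact Finset.prod_eq_zero (Finset.mem_univ i) (if_neg hi)

theorem mem_K {d n : ℕ} {k : Fin d → ℤ} : k ∈ K d n ↔ ∀ i, -(n : ℤ) ≤ k i ∧ k i ≤ n := by
  simp [K]

theorem neg_mem_K {d n : ℕ} {k : Fin d → ℤ} (hk : k ∈ K d n) : -k ∈ K d n := by
  rw [mem_K] at *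
  intro i
  have := hk i
  simp only [Pi.neg_apply]
  omega

theorem zero_mem_K (d n : ℕ) : (0 : Fin d → ℤ) ∈ K d n := by simp [mem_K]

theorem smod_of_mem_K {d n : ℕ} {k : Fin d → ℤ} (hk : k ∈ K d n) : smod n k = k := by
  rw [mem_K] at hk
  funext i
  have := hk i
  rw [smod, Int.emod_eq_of_lt (by omega) (by omega)]
  omega

/-- Two modes in `K` that are congruent modulo `N` coincide. -/
theorem dvd_sub_iff_of_mem_K {d n : ℕ} {k l : Fin d → ℤ} (hk : k ∈ K d n) (hl : l ∈ K d n) :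
    (∀ i, ((2 * n + 1 : ℕ) : ℤ) ∣ (k - l) i) ↔ k = l := by
  rw [mem_K] at hk hl
  refine ⟨fun h => funext fun i => sub_eq_zero.mp (Int.eq_zero_of_abs_lt_dvd (h i) ?_), ?_⟩
  · have := hk i
    have := hl i
    rw [abs_lt]
    push_cast
    omega
  · rintro rfl
    simp

theorem dotZ_comm {d : ℕ} (k p : Fin d → ℤ) : dotZ k p = dotZ p k := by
  simp [dotZ, mul_comm]

theorem dotZ_add {d : ℕ} (k l p : Fin d → ℤ) : dotZ (k + l) p = dotZ k p + dotZ l p := by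
  simp [dotZ, add_mul, Finset.sum_add_distrib]

theorem dotZ_neg {d : ℕ} (k p : Fin d → ℤ) : dotZ (-k) p = -dotZ k p := by
  simp [dotZ]

theorem sum_ω_neg_dotZ {d n : ℕ} {l : Fin d → ℤ} (hl : l ∈ K d n) :
    ∑ p ∈ K d n, ω (2 * n + 1) (-(dotZ l p)) = if l = 0 then (2 * n + 1 : ℂ) ^ d else 0 := by
  simp only [← dotZ_neg]
  have h := dvd_sub_iff_of_mem_K (neg_mem_K hl) (zero_mem_K d n)
  rw [sub_zero, neg_eq_zero] at h
  simp only [sum_ω_dotZ, h]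

theorem two_mul_add_one_pow_ne_zero (n e : ℕ) : (2 * n + 1 : ℂ) ^ e ≠ 0 :=
  pow_ne_zero _ (by exact_mod_cast Nat.succ_ne_zero (2 * n))

/-- Discrete Fourier inversion. -/
theorem sum_Fhat_mul_ω {d n : ℕ} (F : (Fin d → ℤ) → ℂ) {r : Fin d → ℤ} (hr : r ∈ K d n) :
    ∑ l ∈ K d n, Fhat d n F l * ω (2 * n + 1) (dotZ l r) = F r := by
  have key : ∀ p ∈ K d n,
      ∑ l ∈ K d n, F p * ω (2 * n + 1) (-(dotZ l p)) * ω (2 * n + 1) (dotZ l r)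
        = if r = p then (2 * n + 1 : ℂ) ^ d * F p else 0 := by
    intro p hp
    have h : ∀ l : Fin d → ℤ,
        F p * ω (2 * n + 1) (-(dotZ l p)) * ω (2 * n + 1) (dotZ l r)
          = F p * ω (2 * n + 1) (dotZ (r - p) l) := by
      intro l
      rw [mul_assoc, ← ω_add, sub_eq_add_neg, dotZ_add, dotZ_neg, dotZ_comm r, dotZ_comm p,
        add_comm (dotZ l r)]
    simp only [h, ← Finset.mul_sum, sum_ω_dotZ, dvd_sub_iff_of_mem_K hr hp]
    split_ifs <;> ring
  simp only [Fhat, mul_assoc, Finset.sum_mul, ← Finset.mul_sum]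
  rw [Finset.sum_comm]
  simp only [← mul_assoc]
  rw [Finset.sum_congr rfl key, Finset.sum_ite_eq, if_pos hr,
    inv_mul_cancel_left₀ (two_mul_add_one_pow_ne_zero n d)]

/-- Summing the coefficients over `p` and `q` keeps only the modes `l = m = 0`. -/
theorem sum_Acoef (d n : ℕ) (Bh : (Fin d → ℤ) → (Fin d → ℤ) → ℂ) (r s : Fin d → ℤ) :
    ∑ p ∈ K d n, ∑ q ∈ K d n, Acoef d n Bh p q r s
      = ((2 * n + 1 : ℂ) ^ d)⁻¹ * ∑ m ∈ K d n,
          Bh m m * ω (2 * n + 1) (-(dotZ m s)) * ω (2 * n + 1) (dotZ m r) := by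
  set G : (Fin d → ℤ) → (Fin d → ℤ) → ℂ := fun l m => ∑ k ∈ K d n, ∑ j ∈ K d n,
    indN (2 * n + 1) (l + m - k - j) * Bh (smod n (l - j)) (smod n (m - j)) *
      ω (2 * n + 1) (dotZ k r) * ω (2 * n + 1) (dotZ j s) with hG
  have hA : ∀ p q, Acoef d n Bh p q r s = ((2 * n + 1 : ℂ) ^ (3 * d))⁻¹ *
      ∑ l ∈ K d n, ∑ m ∈ K d n,
        ω (2 * n + 1) (-(dotZ l p)) * (ω (2 * n + 1) (-(dotZ m q)) * G l m) := by
    intro p q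
    simp only [Acoef, hG, Finset.mul_sum]
    refine Finset.sum_congr rfl fun l _ => Finset.sum_congr rfl fun m _ =>
      Finset.sum_congr rfl fun k _ => Finset.sum_congr rfl fun j _ => ?_
    ring
  have hG0 : G 0 0 = ∑ m ∈ K d n,
      Bh m m * ω (2 * n + 1) (-(dotZ m s)) * ω (2 * n + 1) (dotZ m r) := by
    refine Finset.sum_congr rfl fun k hk => ?_
    rw [Finset.sum_eq_single_of_mem (-k) (neg_mem_K hk)]
    · simp [indN, smod_of_mem_K hk, dotZ_neg]
      ring
    · intro j hj hjk
      have h := (dvd_sub_iff_of_mem_K (neg_mem_K hk) hj).not.mpr hjk.symm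
      rw [indN, add_zero, zero_sub, if_neg h]
      simp
  have hsum : ∑ p ∈ K d n, ∑ q ∈ K d n, ∑ l ∈ K d n, ∑ m ∈ K d n,
        ω (2 * n + 1) (-(dotZ l p)) * (ω (2 * n + 1) (-(dotZ m q)) * G l m)
      = (2 * n + 1 : ℂ) ^ d * ((2 * n + 1 : ℂ) ^ d * G 0 0) := by
    calc _ = ∑ l ∈ K d n, (∑ p ∈ K d n, ω (2 * n + 1) (-(dotZ l p))) *
          ∑ m ∈ K d n, (∑ q ∈ K d n, ω (2 * n + 1) (-(dotZ m q))) * G l m := by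
          simp only [Finset.sum_mul, Finset.mul_sum]
          rw [Finset.sum_comm_cycle]
          refine Finset.sum_congr rfl fun l _ => ?_
          rw [Finset.sum_comm_cycle]
          exact Finset.sum_congr rfl fun m _ => Finset.sum_comm
      _ = ∑ l ∈ K d n, (if l = 0 then (2 * n + 1 : ℂ) ^ d else 0) *
          ∑ m ∈ K d n, (if m = 0 then (2 * n + 1 : ℂ) ^ d else 0) * G l m :=
          Finset.sum_congr rfl fun l hl => by
            rw [sum_ω_neg_dotZ hl, Finset.sum_congr rfl fun m hm => by rw [sum_ω_neg_dotZ hm]]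
      _ = _ := by simp [zero_mem_K]
  simp only [hA, ← Finset.mul_sum]
  simp only [← Finset.mul_sum] at hsum
  rw [hsum, hG0, pow_mul']
  have := two_mul_add_one_pow_ne_zero n d
  field_simp

/-- Loss part of the Fourier collocation collision term in discrete-velocity form. -/
theorem fcm_loss_dvm_form (d n : ℕ) (hd : 1 ≤ d) (hn : 1 ≤ n)
    (Bh : (Fin d → ℤ) → (Fin d → ℤ) → ℂ)
    (hsym1 : ∀ l ∈ K d n, ∀ m ∈ K d n, Bh l m = Bh m l)
    (hsym2 : ∀ l ∈ K d n, ∀ m ∈ K d n, Bh l m = Bh l (-m))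
    (F : (Fin d → ℤ) → ℂ) (r : Fin d → ℤ) (hr : r ∈ K d n) :
    ∑ p ∈ K d n, ∑ q ∈ K d n, ∑ s ∈ K d n, Acoef d n Bh p q r s * F r * F s
      = ∑ l ∈ K d n, ∑ m ∈ K d n,
          Bh m m * Fhat d n F l * Fhat d n F m * ω (2 * n + 1) (dotZ (l + m) r) := by
  have h : ∀ s, ∑ p ∈ K d n, ∑ q ∈ K d n, Acoef d n Bh p q r s * F r * F s
      = F r * ∑ m ∈ K d n, Bh m m * (((2 * n + 1 : ℂ) ^ d)⁻¹ *
          (F s * ω (2 * n + 1) (-(dotZ m s)))) * ω (2 * n + 1) (dotZ m r) := by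
    intro s
    simp only [← Finset.sum_mul, sum_Acoef]
    simp only [Finset.mul_sum, Finset.sum_mul]
    exact Finset.sum_congr rfl fun m _ => by ring
  calc _ = ∑ s ∈ K d n, ∑ p ∈ K d n, ∑ q ∈ K d n, Acoef d n Bh p q r s * F r * F s := by
        rw [Finset.sum_comm_cycle]
    _ = F r * ∑ m ∈ K d n, Bh m m * Fhat d n F m * ω (2 * n + 1) (dotZ m r) := by
        simp only [h, ← Finset.mul_sum]
        rw [Finset.sum_comm]
        simp only [Fhat, ← Finset.mul_sum, ← Finset.sum_mul]
    _ = _ := by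
        nth_rw 1 [← sum_Fhat_mul_ω F hr]
        rw [Finset.sum_mul_sum]
        refine Finset.sum_congr rfl fun l _ => Finset.sum_congr rfl fun m _ => ?_
        rw [dotZ_add, ω_add]
        ring
end
end

section
/- Let K = {k ∈ ℤ^d : |k_i| ≤ n} with n ≥ 1, and for k ∈ K set σ(k) = Π_{i=1}^d σ_n(k_i), the tensor-product modified Jackson filter. With the classical-form kernel modes B̂(l,m) = ∫_{B_R} ∫_{S^{d−1}} B(g,ω) E_l((g+|g|ω)/2) E_m((g−|g|ω)/2) dω dg, where B(g,ω) = b(|g|, |g·ω|/|g|) with b bounded, measurable and non-negative, the filtered kernel function G^σ(y,z) = Σ_{l,m∈K} σ(l) σ(m) B̂(l,m) E_{−l}(y) E_{−m}(z) is, for every y, z ∈ ℝ^d, a real number and satisfies G^σ(y,z) ≥ 0. -/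
open scoped BigOperators RealInnerProductSpace
open MeasureTheory Metric

noncomputable section

/-- The Fourier character `E_k(v) = exp(iπ (k·v)/T)` on `ℝ^d`. -/
def Ek (d : ℕ) (T : ℝ) (k : Fin d → ℤ) (v : EuclideanSpace ℝ (Fin d)) : ℂ :=
  Complex.exp (Complex.I * (Real.pi : ℂ) * ((∑ i, (k i : ℝ) * v i : ℝ) : ℂ) / (T : ℂ))

/-- The classical-form kernel modes
`B̂(l,m) = ∫_{B_R} ∫_{S^{d−1}} B(g,ω) E_l((g+|g|ω)/2) E_m((g−|g|ω)/2) dω dg`,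
where `B(g,ω) = b(|g|, |g·ω|/|g|)` and the sphere carries its surface measure. -/
def Bhat (d : ℕ) (R T : ℝ) (b : ℝ → ℝ → ℝ) (l m : Fin d → ℤ) : ℂ :=
  ∫ g in closedBall (0 : EuclideanSpace ℝ (Fin d)) R,
    ∫ ω : sphere (0 : EuclideanSpace ℝ (Fin d)) 1,
      ((b ‖g‖ (|⟪g, (ω : EuclideanSpace ℝ (Fin d))⟫| / ‖g‖) : ℝ) : ℂ)
        * Ek d T l ((1 / 2 : ℝ) • (g + ‖g‖ • (ω : EuclideanSpace ℝ (Fin d))))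
        * Ek d T m ((1 / 2 : ℝ) • (g - ‖g‖ • (ω : EuclideanSpace ℝ (Fin d))))
      ∂((volume : Measure (EuclideanSpace ℝ (Fin d))).toSphere)

/-- The one-dimensional modified Jackson filter
`σ_n(β) = [(n+1−|β|) cos(π|β|/(n+1)) + sin(π|β|/(n+1)) cot(π/(n+1))] / (n+1)`. -/
def jackson (n : ℕ) (β : ℤ) : ℝ :=
  (((n : ℝ) + 1 - |(β : ℝ)|) * Real.cos (Real.pi * |(β : ℝ)| / ((n : ℝ) + 1))
      + Real.sin (Real.pi * |(β : ℝ)| / ((n : ℝ) + 1)) * Real.cot (Real.pi / ((n : ℝ) + 1)))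
    / ((n : ℝ) + 1)

/-- The tensor-product modified Jackson filter `σ(k) = Π_i σ_n(k_i)`. -/
def jacksonProd (d n : ℕ) (k : Fin d → ℤ) : ℝ := ∏ i, jackson n (k i)

/-- Telescoping of the sum of cosines in arithmetic progression. -/
theorem two_mul_sin_mul_sum_cos (θ : ℝ) (k L : ℕ) :
    2 * Real.sin θ * ∑ j ∈ Finset.range L, Real.cos (θ * (2 * j + k))
      = Real.sin (θ * (2 * L + k - 1)) - Real.sin (θ * (k - 1)) := by
  induction L with
  | zero => simp
  | succ L ih =>
    rw [Finset.sum_range_succ, mul_add, ih]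
    have h₁ : θ * (2 * ((L + 1 : ℕ) : ℝ) + k - 1) = θ * (2 * L + k) + θ := by push_cast; ring
    have h₂ : θ * (2 * (L : ℝ) + k - 1) = θ * (2 * L + k) - θ := by ring
    rw [h₁, h₂, Real.sin_add, Real.sin_sub]
    ring

/-- The modified Jackson filter is the autocorrelation of `j ↦ sin (π j / (n + 1))`. -/
theorem jackson_natCast (n : ℕ) (hn : 1 ≤ n) (k : ℕ) (hk : k ≤ n) :
    jackson n k = 2 / ((n : ℝ) + 1) * ∑ j ∈ Finset.range (n + 1 - k),
      Real.sin (Real.pi / ((n : ℝ) + 1) * j) * Real.sin (Real.pi / ((n : ℝ) + 1) * (j + k)) := by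
  have hM : (0 : ℝ) < (n : ℝ) + 1 := by positivity
  set θ := Real.pi / ((n : ℝ) + 1) with hθ
  have hθM : θ * ((n : ℝ) + 1) = Real.pi := by rw [hθ]; field_simp
  have hsin : 0 < Real.sin θ := by
    apply Real.sin_pos_of_pos_of_lt_pi
    · positivity
    · rw [hθ, div_lt_iff₀ hM]
      have : (1 : ℝ) ≤ n := by exact_mod_cast hn
      nlinarith [Real.pi_pos]
  have hterm : ∀ j : ℕ, Real.sin (θ * j) * Real.sin (θ * (j + k))
      = (Real.cos (θ * k) - Real.cos (θ * (2 * j + k))) / 2 := by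
    intro j
    have h₁ : θ * k = θ * (j + k) - θ * j := by ring
    have h₂ : θ * (2 * j + k) = θ * (j + k) + θ * j := by ring
    rw [h₁, h₂, Real.cos_sub, Real.cos_add]
    ring
  have hcast : ((n + 1 - k : ℕ) : ℝ) = (n : ℝ) + 1 - k := by
    rw [Nat.cast_sub (by omega)]; push_cast; ring
  have htel := two_mul_sin_mul_sum_cos θ k (n + 1 - k)
  have h₁ : θ * (2 * ((n + 1 - k : ℕ) : ℝ) + k - 1) = 2 * Real.pi - (θ * k + θ) := by
    rw [hcast, ← hθM]; ring
  have h₂ : θ * ((k : ℝ) - 1) = θ * k - θ := by ring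
  rw [h₁, h₂, Real.sin_two_pi_sub, Real.sin_add, Real.sin_sub] at htel
  have hsum : ∑ j ∈ Finset.range (n + 1 - k), Real.cos (θ * (2 * j + k))
      = -(Real.sin (θ * k) * Real.cot θ) := by
    rw [Real.cot_eq_cos_div_sin]
    field_simp
    linarith
  rw [Finset.sum_congr rfl fun j _ => hterm j, ← Finset.sum_div, Finset.sum_sub_distrib, hsum,
    Finset.sum_const, Finset.card_range, nsmul_eq_mul, hcast, jackson]
  have habs : |(((k : ℕ) : ℤ) : ℝ)| = k := by simp
  have hk' : Real.pi * (k : ℝ) / ((n : ℝ) + 1) = θ * k := by rw [hθ]; ring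
  rw [habs, hk']
  field_simp
  ring

theorem jackson_neg (n : ℕ) (β : ℤ) : jackson n (-β) = jackson n β := by
  simp [jackson]

/-- The pairs of indices with a given non-negative difference carry the autocorrelation. -/
theorem sum_filter_sub_eq_natCast (s : ℕ → ℝ) (M k : ℕ) :
    ∑ p ∈ (Finset.range M ×ˢ Finset.range M).filter
        (fun p : ℕ × ℕ => (p.1 : ℤ) - p.2 = k), s p.1 * s p.2
      = ∑ j ∈ Finset.range (M - k), s j * s (j + k) := by
  refine Finset.sum_bij' (fun p _ => p.2) (fun j _ => (j + k, j)) ?_ ?_ ?_ ?_ ?_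
  · rintro ⟨a, c⟩ h
    simp only [Finset.mem_filter, Finset.mem_product, Finset.mem_range] at h ⊢
    omega
  · intro j h
    simp only [Finset.mem_filter, Finset.mem_product, Finset.mem_range] at h ⊢
    omega
  · rintro ⟨a, c⟩ h
    simp only [Finset.mem_filter, Finset.mem_product, Finset.mem_range] at h
    ext <;> simp
    omega
  · simp
  · rintro ⟨a, c⟩ h
    simp only [Finset.mem_filter, Finset.mem_product, Finset.mem_range] at h
    have : a = c + k := by omega
    subst this
    simp [mul_comm]

theorem sum_filter_sub_eq_jackson (n : ℕ) (hn : 1 ≤ n) (β : ℤ)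
    (hβ : β ∈ Finset.Icc (-(n : ℤ)) n) :
    2 / ((n : ℝ) + 1) *
      ∑ p ∈ (Finset.range (n + 1) ×ˢ Finset.range (n + 1)).filter
        (fun p : ℕ × ℕ => (p.1 : ℤ) - p.2 = β),
        Real.sin (Real.pi / ((n : ℝ) + 1) * p.1) * Real.sin (Real.pi / ((n : ℝ) + 1) * p.2)
      = jackson n β := by
  have key : ∀ k : ℕ, k ≤ n → 2 / ((n : ℝ) + 1) *
      ∑ p ∈ (Finset.range (n + 1) ×ˢ Finset.range (n + 1)).filter
        (fun p : ℕ × ℕ => (p.1 : ℤ) - p.2 = k),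
        Real.sin (Real.pi / ((n : ℝ) + 1) * p.1) * Real.sin (Real.pi / ((n : ℝ) + 1) * p.2)
      = jackson n k := by
    intro k hk
    rw [sum_filter_sub_eq_natCast (fun j => Real.sin (Real.pi / ((n : ℝ) + 1) * j)),
      jackson_natCast n hn k hk]
    simp
  rw [Finset.mem_Icc] at hβ
  obtain ⟨k, rfl | rfl⟩ := Int.eq_nat_or_neg β
  · exact key k (by omega)
  · rw [jackson_neg, ← key k (by omega)]
    congr 1
    refine Finset.sum_bij' (fun p _ => p.swap) (fun p _ => p.swap) ?_ ?_ ?_ ?_ ?_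
    · rintro ⟨a, c⟩ h
      simp only [Finset.mem_filter, Finset.mem_product, Finset.mem_range, Prod.swap] at h ⊢
      omega
    · rintro ⟨a, c⟩ h
      simp only [Finset.mem_filter, Finset.mem_product, Finset.mem_range, Prod.swap] at h ⊢
      omega
    · simp
    · simp
    · intro p _
      simp [mul_comm]

/-- The Jackson kernel is a multiple of the squared modulus of a trigonometric polynomial. -/
theorem sum_jackson_mul_exp (n : ℕ) (hn : 1 ≤ n) (x : ℝ) :
    ∑ β ∈ Finset.Icc (-(n : ℤ)) n, (jackson n β : ℂ) * Complex.exp (Complex.I * β * x)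
      = ((2 / ((n : ℝ) + 1) * Complex.normSq (∑ j ∈ Finset.range (n + 1),
          (Real.sin (Real.pi / ((n : ℝ) + 1) * j) : ℂ) * Complex.exp (Complex.I * j * x)) : ℝ) :
          ℂ) := by
  rw [Complex.ofReal_mul, Complex.normSq_eq_conj_mul_self, mul_comm ((starRingEnd ℂ) _), map_sum,
    Finset.sum_mul_sum, ← Finset.sum_product',
    ← Finset.sum_fiberwise_of_maps_to (t := Finset.Icc (-(n : ℤ)) n)
      (g := fun p : ℕ × ℕ => (p.1 : ℤ) - p.2), Finset.mul_sum]
  · refine Finset.sum_congr rfl fun β hβ => ?_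
    rw [← sum_filter_sub_eq_jackson n hn β hβ, Complex.ofReal_mul, mul_assoc, Complex.ofReal_sum,
      Finset.sum_mul]
    congr 1
    refine Finset.sum_congr rfl fun p hp => ?_
    have hβ' : (β : ℂ) = (p.1 : ℂ) - p.2 := by
      rw [← (Finset.mem_filter.mp hp).2]; push_cast; rfl
    have hexp : Complex.exp (Complex.I * β * x)
        = Complex.exp (Complex.I * p.1 * x) * Complex.exp (-Complex.I * p.2 * x) := by
      rw [← Complex.exp_add, hβ']; ring_nf
    rw [map_mul, Complex.conj_ofReal, ← Complex.exp_conj, hexp]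
    simp only [map_mul, Complex.conj_I, Complex.conj_ofReal, Complex.conj_natCast,
      Complex.ofReal_mul]
    ring
  · rintro ⟨a, c⟩ h
    simp only [Finset.mem_product, Finset.mem_range, Finset.mem_Icc] at h ⊢
    omega

theorem Ek_eq_prod (d : ℕ) (T : ℝ) (k : Fin d → ℤ) (v : EuclideanSpace ℝ (Fin d)) :
    Ek d T k v = ∏ i, Complex.exp (Complex.I * k i * (Real.pi * v i / T : ℝ)) := by
  rw [Ek, ← Complex.exp_sum]
  congr 1
  push_cast
  rw [Finset.mul_sum, Finset.sum_div]
  exact Finset.sum_congr rfl fun i _ => by ring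

theorem Ek_sub (d : ℕ) (T : ℝ) (k : Fin d → ℤ) (v w : EuclideanSpace ℝ (Fin d)) :
    Ek d T k (v - w) = Ek d T k v * Ek d T (-k) w := by
  simp only [Ek_eq_prod, ← Finset.prod_mul_distrib, ← Complex.exp_add]
  refine Finset.prod_congr rfl fun i _ => ?_
  congr 1
  simp only [PiLp.sub_apply, Pi.neg_apply]
  push_cast
  ring

theorem norm_Ek (d : ℕ) (T : ℝ) (k : Fin d → ℤ) (v : EuclideanSpace ℝ (Fin d)) :
    ‖Ek d T k v‖ = 1 := by
  rw [Ek, show Complex.I * (Real.pi : ℂ) * ((∑ i, (k i : ℝ) * v i : ℝ) : ℂ) / (T : ℂ)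
    = ((Real.pi * (∑ i, (k i : ℝ) * v i) / T : ℝ) : ℂ) * Complex.I by push_cast; ring]
  exact Complex.norm_exp_ofReal_mul_I _

theorem continuous_Ek (d : ℕ) (T : ℝ) (k : Fin d → ℤ) : Continuous (Ek d T k) := by
  unfold Ek
  fun_prop

/-- The tensor-product Jackson kernel is real and non-negative. -/
theorem exists_sum_jacksonProd_mul_Ek_eq (d : ℕ) (T : ℝ) (n : ℕ) (hn : 1 ≤ n)
    (w : EuclideanSpace ℝ (Fin d)) :
    ∃ q : ℝ, 0 ≤ q ∧ ∑ k ∈ K d n, (jacksonProd d n k : ℂ) * Ek d T k w = q := by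
  refine ⟨∏ i, (2 / ((n : ℝ) + 1) * Complex.normSq (∑ j ∈ Finset.range (n + 1),
      (Real.sin (Real.pi / ((n : ℝ) + 1) * j) : ℂ)
        * Complex.exp (Complex.I * j * (Real.pi * w i / T : ℝ)))), ?_, ?_⟩
  · exact Finset.prod_nonneg fun i _ => mul_nonneg (by positivity) (Complex.normSq_nonneg _)
  · rw [Complex.ofReal_prod]
    simp_rw [← sum_jackson_mul_exp n hn]
    rw [Finset.prod_univ_sum]
    refine Finset.sum_congr rfl fun k _ => ?_
    rw [jacksonProd, Ek_eq_prod, Complex.ofReal_prod, ← Finset.prod_mul_distrib]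

/-- The product measure on `B_R × S^{d-1}`. -/
def kernelMeasure (d : ℕ) (R : ℝ) :
    Measure (EuclideanSpace ℝ (Fin d) × sphere (0 : EuclideanSpace ℝ (Fin d)) 1) :=
  ((volume : Measure (EuclideanSpace ℝ (Fin d))).restrict (closedBall 0 R)).prod
    (volume : Measure (EuclideanSpace ℝ (Fin d))).toSphere

/-- The integrand of the kernel modes. -/
def kernelIntegrand (d : ℕ) (T : ℝ) (b : ℝ → ℝ → ℝ) (l m : Fin d → ℤ)
    (p : EuclideanSpace ℝ (Fin d) × sphere (0 : EuclideanSpace ℝ (Fin d)) 1) : ℂ :=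
  ((b ‖p.1‖ (|⟪p.1, (p.2 : EuclideanSpace ℝ (Fin d))⟫| / ‖p.1‖) : ℝ) : ℂ)
    * Ek d T l ((1 / 2 : ℝ) • (p.1 + ‖p.1‖ • (p.2 : EuclideanSpace ℝ (Fin d))))
    * Ek d T m ((1 / 2 : ℝ) • (p.1 - ‖p.1‖ • (p.2 : EuclideanSpace ℝ (Fin d))))

theorem integrable_kernelIntegrand (d : ℕ) (R T : ℝ) (b : ℝ → ℝ → ℝ)
    (hb_meas : Measurable (Function.uncurry b)) (hb_bdd : ∃ M : ℝ, ∀ x y : ℝ, b x y ≤ M)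
    (hb_nonneg : ∀ x y : ℝ, 0 ≤ b x y) (l m : Fin d → ℤ) :
    Integrable (kernelIntegrand d T b l m) (kernelMeasure d R) := by
  obtain ⟨M, hM⟩ := hb_bdd
  have : IsFiniteMeasure ((volume : Measure (EuclideanSpace ℝ (Fin d))).restrict
      (closedBall 0 R)) := isFiniteMeasure_restrict.2 measure_closedBall_lt_top.ne
  have : IsFiniteMeasure (kernelMeasure d R) := by
    unfold kernelMeasure
    infer_instance
  refine Integrable.of_bound (C := M) (Measurable.aestronglyMeasurable ?_) (ae_of_all _ fun p => ?_)
  · have hb : Measurable fun p : EuclideanSpace ℝ (Fin d) ×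
        sphere (0 : EuclideanSpace ℝ (Fin d)) 1 =>
        b ‖p.1‖ (|⟪p.1, (p.2 : EuclideanSpace ℝ (Fin d))⟫| / ‖p.1‖) := by
      refine hb_meas.comp (Measurable.prodMk (by fun_prop) (Measurable.div ?_ (by fun_prop)))
      exact Continuous.measurable (by fun_prop)
    refine ((Complex.measurable_ofReal.comp hb).mul ?_).mul ?_
    · exact ((continuous_Ek d T l).comp (by fun_prop)).measurable
    · exact ((continuous_Ek d T m).comp (by fun_prop)).measurable
  · rw [kernelIntegrand, norm_mul, norm_mul, norm_Ek, norm_Ek, mul_one, mul_one,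
      Complex.norm_of_nonneg (hb_nonneg _ _)]
    exact hM _ _

theorem Bhat_eq_integral (d : ℕ) (R T : ℝ) (b : ℝ → ℝ → ℝ)
    (hb_meas : Measurable (Function.uncurry b)) (hb_bdd : ∃ M : ℝ, ∀ x y : ℝ, b x y ≤ M)
    (hb_nonneg : ∀ x y : ℝ, 0 ≤ b x y) (l m : Fin d → ℤ) :
    Bhat d R T b l m = ∫ p, kernelIntegrand d T b l m p ∂kernelMeasure d R :=
  (integral_prod _ (integrable_kernelIntegrand d R T b hb_meas hb_bdd hb_nonneg l m)).symm

/-- The filtered kernel function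
`G^σ(y,z) = Σ_{l,m ∈ K} σ(l) σ(m) B̂(l,m) E_{−l}(y) E_{−m}(z)` is real and non-negative. -/
theorem filtered_kernel_nonneg (d : ℕ) (hd : 2 ≤ d) (R T : ℝ) (hR : 0 < R) (hT : 0 < T)
    (b : ℝ → ℝ → ℝ) (hb_meas : Measurable (Function.uncurry b))
    (hb_bdd : ∃ M : ℝ, ∀ x y : ℝ, b x y ≤ M) (hb_nonneg : ∀ x y : ℝ, 0 ≤ b x y)
    (n : ℕ) (hn : 1 ≤ n) (y z : EuclideanSpace ℝ (Fin d)) :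
    (∑ l ∈ K d n, ∑ m ∈ K d n,
        ((jacksonProd d n l : ℝ) : ℂ) * ((jacksonProd d n m : ℝ) : ℂ)
          * Bhat d R T b l m * Ek d T (-l) y * Ek d T (-m) z).im = 0
      ∧ 0 ≤ (∑ l ∈ K d n, ∑ m ∈ K d n,
          ((jacksonProd d n l : ℝ) : ℂ) * ((jacksonProd d n m : ℝ) : ℂ)
            * Bhat d R T b l m * Ek d T (-l) y * Ek d T (-m) z).re := by
  have hker_int := integrable_kernelIntegrand d R T b hb_meas hb_bdd hb_nonneg
  choose Q hQ hQeq using exists_sum_jacksonProd_mul_Ek_eq d T n hn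
  set u : EuclideanSpace ℝ (Fin d) × sphere (0 : EuclideanSpace ℝ (Fin d)) 1 →
    EuclideanSpace ℝ (Fin d) := fun p => (1 / 2 : ℝ) • (p.1 + ‖p.1‖ • (p.2 : _))
  set v : EuclideanSpace ℝ (Fin d) × sphere (0 : EuclideanSpace ℝ (Fin d)) 1 →
    EuclideanSpace ℝ (Fin d) := fun p => (1 / 2 : ℝ) • (p.1 - ‖p.1‖ • (p.2 : _))
  have hG : (∑ l ∈ K d n, ∑ m ∈ K d n,
        ((jacksonProd d n l : ℝ) : ℂ) * ((jacksonProd d n m : ℝ) : ℂ)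
          * Bhat d R T b l m * Ek d T (-l) y * Ek d T (-m) z)
      = ((∫ p, b ‖p.1‖ (|⟪p.1, (p.2 : EuclideanSpace ℝ (Fin d))⟫| / ‖p.1‖)
          * (Q (u p - y) * Q (v p - z)) ∂kernelMeasure d R : ℝ) : ℂ) := by
    rw [← integral_complex_ofReal]
    have hterm : ∀ l m, ((jacksonProd d n l : ℝ) : ℂ) * ((jacksonProd d n m : ℝ) : ℂ)
          * Bhat d R T b l m * Ek d T (-l) y * Ek d T (-m) z
        = ∫ p, ((jacksonProd d n l : ℝ) : ℂ) * ((jacksonProd d n m : ℝ) : ℂ)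
          * kernelIntegrand d T b l m p * Ek d T (-l) y * Ek d T (-m) z ∂kernelMeasure d R := by
      intro l m
      rw [integral_mul_const, integral_mul_const, integral_const_mul,
        Bhat_eq_integral d R T b hb_meas hb_bdd hb_nonneg]
    have hterm_int : ∀ l m, Integrable (fun p => ((jacksonProd d n l : ℝ) : ℂ)
        * ((jacksonProd d n m : ℝ) : ℂ) * kernelIntegrand d T b l m p
        * Ek d T (-l) y * Ek d T (-m) z) (kernelMeasure d R) := fun l m =>
      (((hker_int l m).const_mul _).mul_const _).mul_const _
    simp_rw [hterm]
    rw [Finset.sum_congr rfl fun l _ => (integral_finsetSum _ fun m _ => hterm_int l m).symm,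
      ← integral_finsetSum _ fun l _ => integrable_finsetSum _ fun m _ => hterm_int l m]
    refine integral_congr_ae (ae_of_all _ fun p => ?_)
    simp only [Complex.ofReal_mul]
    rw [← hQeq, ← hQeq, Finset.sum_mul_sum, Finset.mul_sum]
    refine Finset.sum_congr rfl fun l _ => ?_
    rw [Finset.mul_sum]
    refine Finset.sum_congr rfl fun m _ => ?_
    rw [Ek_sub, Ek_sub, kernelIntegrand]
    ring
  rw [hG]
  refine ⟨Complex.ofReal_im _, ?_⟩
  rw [Complex.ofReal_re]
  exact integral_nonneg fun p => mul_nonneg (hb_nonneg _ _) (mul_nonneg (hQ _) (hQ _))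
end
end
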